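/- arXiv:1801.07953 — 2 statements merged into one kernel-verified Lean document; each statement's English description precedes it below -/
import Mathlib

section
/- Let H be a complex Hilbert space, n ∈ ℕ, and A₁,…,Aₙ, B₁,…,Bₙ, X ∈ B(H). Then, with S = Σ_{j=1}^n Aⱼ* X Bⱼ, one has S* S ≤ ‖Σ_{j=1}^n Aⱼ* Aⱼ‖ · Σ_{j=1}^n Bⱼ* X* X Bⱼ in the order of B(H). -/
open ContinuousLinearMap

/-- With `S = Σ Aⱼ* X Bⱼ`, one has `S* S ≤ ‖Σ Aⱼ* Aⱼ‖ • Σ Bⱼ* X* X Bⱼ`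
in the Loewner order of `B(H)`. -/
theorem adjoint_sum_mul_sum_le
    {H : Type*} [NormedAddCommGroup H] [InnerProductSpace ℂ H] [CompleteSpace H]
    (n : ℕ) (A B : Fin n → H →L[ℂ] H) (X : H →L[ℂ] H) :
    adjoint (∑ j, adjoint (A j) * X * B j) * (∑ j, adjoint (A j) * X * B j) ≤
      ‖∑ j, adjoint (A j) * A j‖ • ∑ j, adjoint (B j) * adjoint X * X * B j := by
  set S := ∑ j, adjoint (A j) * X * B j with hS
  set P := ∑ j, adjoint (A j) * A j with hP
  set Q := ∑ j, adjoint (B j) * adjoint X * X * B j with hQ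
  have hQsa : IsSelfAdjoint Q := by
    rw [hQ]
    refine isSelfAdjoint_sum _ fun j _ => ?_
    simp only [← star_eq_adjoint]
    simp [IsSelfAdjoint, mul_assoc]
  have hsa : IsSelfAdjoint (‖P‖ • Q - adjoint S * S) := by
    refine IsSelfAdjoint.sub (IsSelfAdjoint.smul (by simp [IsSelfAdjoint]) hQsa) ?_
    rw [← star_eq_adjoint]
    exact IsSelfAdjoint.star_mul_self S
  rw [ContinuousLinearMap.le_def, ContinuousLinearMap.isPositive_def']
  refine ⟨hsa, fun v => ?_⟩
  have hPu : ∀ u, ∑ j, ‖A j u‖ ^ 2 ≤ ‖P‖ * ‖u‖ ^ 2 := by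
    intro u
    have h1 : ∑ j, ‖A j u‖ ^ 2 = RCLike.re (inner ℂ (P u) u) := by
      simp [hP, sum_apply, adjoint_inner_left, ← Complex.ofReal_pow]
    rw [h1]
    calc _ ≤ ‖inner ℂ (P u) u‖ := RCLike.re_le_norm _
      _ ≤ ‖P u‖ * ‖u‖ := norm_inner_le_norm _ _
      _ ≤ ‖P‖ * ‖u‖ * ‖u‖ := by gcongr; exact P.le_opNorm u
      _ = _ := by ring
  have hQv : RCLike.re (inner ℂ (Q v) v) = ∑ j, ‖X (B j v)‖ ^ 2 := by
    simp [hQ, sum_apply, adjoint_inner_left, ← Complex.ofReal_pow]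
  have hSv : ‖S v‖ ^ 2 ≤ ∑ j, ‖A j (S v)‖ * ‖X (B j v)‖ := by
    have h1 : inner ℂ (S v) (S v) = ∑ j, inner ℂ (X (B j v)) (A j (S v)) := by
      conv_lhs => enter [2]; rw [hS]
      simp [sum_apply, adjoint_inner_left]
    rw [← inner_self_eq_norm_sq (𝕜 := ℂ), h1]
    calc _ ≤ ‖∑ j, inner ℂ (X (B j v)) (A j (S v))‖ := RCLike.re_le_norm _
      _ ≤ ∑ j, ‖inner ℂ (X (B j v)) (A j (S v))‖ := norm_sum_le _ _
      _ ≤ _ := Finset.sum_le_sum fun j _ => by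
        rw [mul_comm]; exact norm_inner_le_norm _ _
  have hfin : ‖S v‖ ^ 2 ≤ ‖P‖ * ∑ j, ‖X (B j v)‖ ^ 2 := by
    have hq : 0 ≤ ∑ j, ‖X (B j v)‖ ^ 2 := by positivity
    rcases (sq_nonneg ‖S v‖).eq_or_lt with h0 | h0
    · rw [← h0]; positivity
    · have h2 : (‖S v‖ ^ 2) ^ 2 ≤ (‖P‖ * ‖S v‖ ^ 2) * ∑ j, ‖X (B j v)‖ ^ 2 :=
        calc _ ≤ (∑ j, ‖A j (S v)‖ * ‖X (B j v)‖) ^ 2 := by gcongr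
          _ ≤ _ := Finset.sum_mul_sq_le_sq_mul_sq _ _ _
          _ ≤ _ := by gcongr; exact hPu _
      refine le_of_mul_le_mul_left ?_ h0
      linarith
  have hgoal : (‖P‖ • Q - adjoint S * S).reApplyInnerSelf v
      = ‖P‖ * RCLike.re (inner ℂ (Q v) v) - ‖S v‖ ^ 2 := by
    rw [reApplyInnerSelf_apply, sub_apply, inner_sub_left, map_sub,
      show (adjoint S * S) v = adjoint S (S v) from rfl,
      adjoint_inner_left, inner_self_eq_norm_sq, smul_apply, ← Complex.coe_smul, inner_smul_left]
    simp
  rw [hgoal, hQv]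
  linarith
end

section
/- Let H be a complex Hilbert space, α > 0 a real number, and let x, y ∈ B(H) be normal operators with ‖x‖ < 1 and ‖y‖ < 1. Then for every a ∈ B(H): ‖(1 − x*x)^{α/2} · a · (1 − y*y)^{α/2}‖ ≤ ‖Σ_{n=0}^∞ (−1)ⁿ C(α,n) x*ⁿ a yⁿ‖, where C(α,n) = (Π_{k=0}^{n−1}(α−k))/n! is the generalized binomial coefficient, the series converges absolutely in B(H), and (1 − x*x)^{α/2} is defined by continuous functional calculus applied to the positive operator 1 − x*x. -/
set_option synthInstance.maxHeartbeats 400000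

open ContinuousLinearMap

/-- The generalized binomial coefficient `C(α, n) = α(α−1)⋯(α−n+1)/n!`. -/
noncomputable def genBinom (α : ℝ) (n : ℕ) : ℝ :=
  (∏ k ∈ Finset.range n, (α - k)) / n.factorial

namespace BinSer

/-- Coefficients of `(1 - t)^β`. -/
noncomputable def cd (β : ℝ) (n : ℕ) : ℝ := (-1 : ℝ) ^ n * genBinom β n

theorem genBinom_eq (β : ℝ) (n : ℕ) : genBinom β n = Ring.choose β n := by
  have h : (descPochhammer ℤ n).smeval β = ∏ k ∈ Finset.range n, (β - k) := by
    induction n with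
    | zero => simp
    | succ n ih =>
      rw [descPochhammer_succ_right, Polynomial.smeval_mul, ih, Finset.prod_range_succ]
      simp [Polynomial.smeval_sub, Polynomial.smeval_natCast]
  rw [Ring.choose_eq_smul, h, genBinom, smul_eq_mul, div_eq_inv_mul]

theorem cd_nonneg {α : ℝ} (hα : 0 < α) (n : ℕ) : 0 ≤ cd (-α) n := by
  have h : cd (-α) n = (∏ k ∈ Finset.range n, (α + k)) / n.factorial := by
    unfold cd genBinom
    rw [← mul_div_assoc]
    congr 1
    induction n with
    | zero => simp
    | succ n ih =>
      rw [Finset.prod_range_succ, Finset.prod_range_succ, ← ih, pow_succ]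
      ring
  rw [h]
  positivity

theorem cd_zero (n : ℕ) : cd 0 n = if n = 0 then 1 else 0 := by
  unfold cd
  rw [genBinom_eq]
  rcases n with _ | n
  · simp
  · simp [Ring.choose_zero_succ]

theorem cd_add (β γ : ℝ) (n : ℕ) :
    cd (β + γ) n = ∑ ij ∈ Finset.HasAntidiagonal.antidiagonal n, cd β ij.1 * cd γ ij.2 := by
  simp only [cd, genBinom_eq]
  rw [Ring.add_choose_eq n (Commute.all β γ), Finset.mul_sum]
  refine Finset.sum_congr rfl fun ij hij => ?_
  rw [← Finset.HasAntidiagonal.mem_antidiagonal.mp hij, pow_add]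
  ring

theorem summable_abs (β : ℝ) {r : ℝ} (hr0 : 0 ≤ r) (hr : r < 1) :
    Summable (fun n => |cd β n| * r ^ n) := by
  lift r to NNReal using hr0
  have h := (binomialSeries ℝ β).summable_norm_mul_pow (r := r)
    (lt_of_lt_of_le (by exact_mod_cast hr) binomialSeries_radius_ge_one)
  refine h.congr fun n => ?_
  simp [cd, genBinom_eq, binomialSeries, abs_mul]

theorem hasSum_real (β : ℝ) {t : ℝ} (ht : |t| < 1) :
    HasSum (fun n => cd β n * t ^ n) ((1 - t) ^ β) := by
  have h := (Real.one_add_rpow_hasFPowerSeriesOnBall_zero (a := β)).hasSum (y := -t)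
    (by simpa [Real.enorm_eq_ofReal_abs] using ht)
  rw [zero_add, ← sub_eq_add_neg] at h
  refine (h.congr_fun ?_)
  intro n
  rw [binomialSeries_apply, List.ofFn_const, List.prod_replicate, smul_eq_mul, neg_pow, cd,
    genBinom_eq]
  ring

section alg
variable {A : Type*} [NormedRing A] [NormedAlgebra ℝ A] 

theorem norm_cd_smul_le (β : ℝ) (T : A) (n : ℕ) (B : A) :
    ‖cd β n • (T ^ n * B)‖ ≤ (|cd β n| * ‖T‖ ^ n) * ‖B‖ := by
  rw [norm_smul, Real.norm_eq_abs, mul_assoc]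
  gcongr
  rcases n with _ | n
  · simp
  · exact (norm_mul_le _ _).trans (by gcongr; exact norm_pow_le' _ n.succ_pos)

theorem summable_norm_cd (β : ℝ) {T : A} (hT : ‖T‖ < 1) :
    Summable (fun n => ‖cd β n • T ^ n‖) := by
  refine Summable.of_nonneg_of_le (fun _ => norm_nonneg _) (fun n => ?_)
    ((summable_abs β (norm_nonneg T) hT).mul_right ‖(1 : A)‖)
  simpa using norm_cd_smul_le β T n 1

/-- `(1 - T)^β` as a power series. -/
noncomputable def f (β : ℝ) (T : A) : A := ∑' n, cd β n • T ^ n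

theorem hasSum_f [CompleteSpace A] (β : ℝ) {T : A} (hT : ‖T‖ < 1) :
    HasSum (fun n => cd β n • T ^ n) (f β T) :=
  (summable_norm_cd β hT).of_norm.hasSum

theorem f_mul [CompleteSpace A] (β γ : ℝ) {T : A} (hT : ‖T‖ < 1) : f β T * f γ T = f (β + γ) T := by
  unfold f
  rw [tsum_mul_tsum_eq_tsum_sum_antidiagonal_of_summable_norm (summable_norm_cd β hT)
    (summable_norm_cd γ hT)]
  refine tsum_congr fun n => ?_
  rw [cd_add, Finset.sum_smul]
  refine Finset.sum_congr rfl fun ij hij => ?_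
  rw [← Finset.HasAntidiagonal.mem_antidiagonal.mp hij, pow_add, smul_mul_smul_comm]


theorem f_zero (T : A) : f 0 T = 1 := by
  unfold f
  rw [tsum_eq_single 0]
  · simp [cd_zero]
  · intro n hn
    simp [cd_zero, hn]

end alg


section op
variable {H : Type*} [NormedAddCommGroup H] [InnerProductSpace ℂ H] [CompleteSpace H]

theorem rpow_eq_f (β : ℝ) (T : H →L[ℂ] H) (hT0 : 0 ≤ T) (hT : ‖T‖ < 1) :
    CFC.rpow (1 - T) β = f β T := by
  have hsa : IsSelfAdjoint T := hT0.isSelfAdjoint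
  have hsp : ∀ t ∈ spectrum ℝ T, |t| < 1 := fun t ht => by
    rcases subsingleton_or_nontrivial (H →L[ℂ] H) with h | h
    · simp [spectrum.of_subsingleton] at ht
    exact lt_of_le_of_lt (spectrum.norm_le_norm_of_mem ht) hT
  have hpos : ∀ t ∈ spectrum ℝ T, 0 < 1 - t := fun t ht => by
    have := (abs_lt.mp (hsp t ht)).2
    linarith
  have h1 : (1 : H →L[ℂ] H) - T = cfc (fun t : ℝ => 1 - t) T := by
    rw [cfc_sub (fun _ : ℝ => (1 : ℝ)) (fun t => t) T, cfc_const_one ℝ T, cfc_id' ℝ T]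
  have hc : ContinuousOn (fun t : ℝ => (1 - t) ^ β) (spectrum ℝ T) :=
    ContinuousOn.rpow_const (by fun_prop) (fun t ht => Or.inl (hpos t ht).ne')
  rw [CFC.rpow_eq_pow, h1, CFC.cfc_rpow hpos (by fun_prop) hsa, cfc_apply _ T hsa hc]
  set X : C(spectrum ℝ T, ℝ) := ContinuousMap.restrict (spectrum ℝ T) (ContinuousMap.id ℝ) with hX
  have hXn : ‖X‖ < 1 := by
    rw [ContinuousMap.norm_lt_iff _ one_pos]
    intro t
    exact hsp t t.2
  have hs := hasSum_f β hXn
  have h2 := hs.map (cfcHom hsa : C(spectrum ℝ T, ℝ) →⋆ₐ[ℝ] (H →L[ℂ] H)) (cfcHom_continuous hsa)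
  have h3 : f β T = cfcHom hsa (f β X) := by
    refine (hasSum_f β hT).unique ?_
    refine h2.congr_fun ?_
    intro n
    simp only [Function.comp, map_smul, map_pow]
    rw [hX, cfcHom_id hsa]
  rw [h3]
  congr 1
  ext t
  have h4 := hs.map (ContinuousMap.evalCLM ℝ t) (ContinuousMap.evalCLM ℝ t).continuous
  refine (hasSum_real β (hsp t t.2)).unique ?_
  refine h4.congr_fun ?_
  intro n
  simp [hX]

theorem norm_star_mul_lt {y : H →L[ℂ] H} (hyn : ‖y‖ < 1) : ‖star y * y‖ < 1 := by
  rw [CStarRing.norm_star_mul_self]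
  nlinarith [norm_nonneg y]

theorem hasSum_sq (α : ℝ) (y : H →L[ℂ] H) (hy : IsStarNormal y) (hyn : ‖y‖ < 1) (ξ : H) :
    HasSum (fun n => cd (-α) n * ‖(y ^ n) (CFC.rpow (1 - star y * y) (α / 2) ξ)‖ ^ 2)
      (‖ξ‖ ^ 2) := by
  set q := CFC.rpow (1 - star y * y) (α / 2) with hq
  have hTn := norm_star_mul_lt hyn
  have hqf : q = f (α / 2) (star y * y) := rpow_eq_f _ _ (star_mul_self_nonneg y) hTn
  have hqs : star q = q := (CFC.rpow_nonneg (a := 1 - star y * y) (y := α / 2)).isSelfAdjoint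
  have hqq : q * (f (-α) (star y * y) * q) = 1 := by
    rw [hqf, f_mul _ _ hTn, f_mul _ _ hTn, ← f_zero (star y * y)]
    congr 1
    ring
  let φ : (H →L[ℂ] H) →L[ℝ] ℝ :=
    Complex.reCLM ∘L (((innerSL ℂ (q ξ)) ∘L (ContinuousLinearMap.apply ℂ H (q ξ))).restrictScalars ℝ)
  have hφ : ∀ B : H →L[ℂ] H, φ B = (inner ℂ (q ξ) (B (q ξ))).re := fun B => rfl
  have h := (hasSum_f (-α) hTn).map φ φ.continuous
  have hval : φ (f (-α) (star y * y)) = ‖ξ‖ ^ 2 := by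
    rw [hφ]
    nth_rewrite 1 [← hqs]
    rw [star_eq_adjoint, adjoint_inner_left]
    have : q (f (-α) (star y * y) (q ξ)) = ξ := by
      have := congrArg (fun B : H →L[ℂ] H => B ξ) hqq
      simpa using this
    rw [this]
    exact inner_self_eq_norm_sq (𝕜 := ℂ) ξ
  rw [hval] at h
  refine h.congr_fun ?_
  intro n
  have hc : Commute (star y) y := hy.star_comm_self
  simp only [Function.comp, map_smul, smul_eq_mul]
  rw [hφ, hc.mul_pow, ← star_pow, mul_apply_eq_comp, star_eq_adjoint, adjoint_inner_right]
  congr 1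
  exact (inner_self_eq_norm_sq (𝕜 := ℂ) _).symm

theorem L_pow (b y a : H →L[ℂ] H) (n : ℕ) :
    ((ContinuousLinearMap.mulLeftRight ℝ (H →L[ℂ] H) b y) ^ n) a = b ^ n * a * y ^ n := by
  induction n generalizing a with
  | zero => simp
  | succ n ih =>
    rw [pow_succ, mul_apply_eq_comp, ih, pow_succ, pow_succ']
    simp [mul_assoc]

end op

end BinSer

/-- For normal strict contractions `x`, `y` and `α > 0`, the series
`Σ (−1)ⁿ C(α,n) x*ⁿ a yⁿ` converges absolutely and
`‖(1 − x*x)^{α/2} a (1 − y*y)^{α/2}‖ ≤ ‖Σ_{n} (−1)ⁿ C(α,n) x*ⁿ a yⁿ‖`, where powers of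
positive operators are taken by the continuous functional calculus. -/
theorem norm_rpow_mul_rpow_le_norm_binomial_series
    {H : Type*} [NormedAddCommGroup H] [InnerProductSpace ℂ H] [CompleteSpace H]
    (α : ℝ) (hα : 0 < α)
    (x y : H →L[ℂ] H) (hx : IsStarNormal x) (hy : IsStarNormal y)
    (hxn : ‖x‖ < 1) (hyn : ‖y‖ < 1) (a : H →L[ℂ] H) :
    Summable (fun n : ℕ => ‖((-1 : ℝ) ^ n * genBinom α n) •
        ((adjoint x) ^ n * a * y ^ n)‖) ∧
      ‖CFC.rpow (1 - adjoint x * x) (α / 2) * a * CFC.rpow (1 - adjoint y * y) (α / 2)‖ ≤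
        ‖∑' n : ℕ, ((-1 : ℝ) ^ n * genBinom α n) • ((adjoint x) ^ n * a * y ^ n)‖ := by
  set L := ContinuousLinearMap.mulLeftRight ℝ (H →L[ℂ] H) (adjoint x) y with hL
  have hLn : ‖L‖ < 1 := by
    refine lt_of_le_of_lt (ContinuousLinearMap.opNorm_mulLeftRight_apply_apply_le ℝ _ _ _) ?_
    rw [LinearIsometryEquiv.norm_map]
    nlinarith [norm_nonneg x, norm_nonneg y]
  have hterm : ∀ (β : ℝ) (c : H →L[ℂ] H) (n : ℕ),
      (BinSer.cd β n • L ^ n) c =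
        ((-1 : ℝ) ^ n * genBinom β n) • ((adjoint x) ^ n * c * y ^ n) := by
    intro β c n
    rw [← BinSer.L_pow]
    rfl
  have hsum : ∀ (β : ℝ) (c : H →L[ℂ] H),
      HasSum (fun n : ℕ => ((-1 : ℝ) ^ n * genBinom β n) • ((adjoint x) ^ n * c * y ^ n))
        (BinSer.f β L c) := by
    intro β c
    have h := (BinSer.hasSum_f β hLn).map
      (ContinuousLinearMap.apply ℝ (H →L[ℂ] H) c)
      (ContinuousLinearMap.apply ℝ (H →L[ℂ] H) c).continuous
    refine h.congr_fun ?_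
    intro n
    exact (hterm β c n).symm
  refine ⟨?_, ?_⟩
  · refine Summable.of_nonneg_of_le (fun _ => norm_nonneg _) (fun n => ?_)
      ((BinSer.summable_norm_cd α hLn).mul_right ‖a‖)
    rw [← hterm]
    exact ContinuousLinearMap.le_opNorm _ _
  rw [(hsum α a).tsum_eq]
  set b := BinSer.f α L a with hb
  have ha : BinSer.f (-α) L b = a := by
    rw [hb, ← mul_apply_eq_comp, BinSer.f_mul _ _ hLn, neg_add_cancel, BinSer.f_zero]
    rfl
  have hsa := hsum (-α) b
  rw [ha] at hsa
  refine ContinuousLinearMap.opNorm_le_of_re_inner_le (norm_nonneg _) fun ξ η hξ hη => ?_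
  have hxs := BinSer.hasSum_sq α x hx hxn η
  have hys := BinSer.hasSum_sq α y hy hyn ξ
  rw [star_eq_adjoint] at hxs hys
  have hps : star (CFC.rpow (1 - adjoint x * x) (α / 2)) = CFC.rpow (1 - adjoint x * x) (α / 2) :=
    (CFC.rpow_nonneg (a := 1 - adjoint x * x) (y := α / 2)).isSelfAdjoint
  set p := CFC.rpow (1 - adjoint x * x) (α / 2) with hp
  set q := CFC.rpow (1 - adjoint y * y) (α / 2) with hq
  let φ : (H →L[ℂ] H) →L[ℝ] ℝ :=
    Complex.reCLM ∘L (((innerSL ℂ (p η)) ∘L (ContinuousLinearMap.apply ℂ H (q ξ))).restrictScalars ℝ)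
  have hφ : ∀ B : H →L[ℂ] H, φ B = (inner ℂ (p η) (B (q ξ))).re := fun B => rfl
  have h := hsa.map φ φ.continuous
  have hval : RCLike.re (inner ℂ ((p * a * q) ξ) η) = φ a := by
    rw [hφ, inner_re_symm]
    nth_rewrite 2 [← hps]
    rw [star_eq_adjoint, adjoint_inner_left]
    rfl
  rw [hval]
  have hbound := (hys.add hxs).mul_left (‖b‖ / 2)
  rw [hξ, hη] at hbound
  have hle := hasSum_le (fun n => ?_) h hbound
  · linarith
  have hc := BinSer.cd_nonneg hα n
  change φ (BinSer.cd (-α) n • _) ≤ _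
  rw [map_smul, hφ, smul_eq_mul]
  set u := (y ^ n) (q ξ) with hu
  set v := (x ^ n) (p η) with hv
  have h1 : inner ℂ (p η) (((adjoint x) ^ n * b * y ^ n) (q ξ)) = inner ℂ v (b u) := by
    rw [hv, hu, ← star_eq_adjoint, ← star_pow, star_eq_adjoint, mul_apply_eq_comp,
      mul_apply_eq_comp, adjoint_inner_right]
  rw [h1]
  have h2 : (inner ℂ v (b u)).re ≤ ‖v‖ * (‖b‖ * ‖u‖) :=
    ((Complex.re_le_norm _).trans (norm_inner_le_norm _ _)).trans
      (by gcongr; exact b.le_opNorm u)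
  have h3 : ‖v‖ * (‖b‖ * ‖u‖) ≤ ‖b‖ / 2 * (‖u‖ ^ 2 + ‖v‖ ^ 2) := by
    nlinarith [norm_nonneg b, mul_nonneg (norm_nonneg b) (sq_nonneg (‖u‖ - ‖v‖))]
  calc BinSer.cd (-α) n * (inner ℂ v (b u)).re
      ≤ BinSer.cd (-α) n * (‖b‖ / 2 * (‖u‖ ^ 2 + ‖v‖ ^ 2)) :=
        mul_le_mul_of_nonneg_left (h2.trans h3) hc
    _ = _ := by ring
end
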